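/- arXiv:1206.6690 — 2 statements merged into one kernel-verified Lean document; each statement's English description precedes it below -/
import Mathlib

section
/- Let G be a cubic graph with an even 2-factor F, and let e and e' be two disjoint edges of G that lie on the same cycle (connected component) of F. Then the graph G' obtained from G by applying the edge-insertion operation to e and e' is colourable. -/
open scoped Classical

namespace SnarkPaper

variable {V : Type*}

/-- A graph is cubic if every vertex has exactly 3 neighbours. -/
def IsCubic (G : SimpleGraph V) : Prop := ∀ v : V, (G.neighborSet v).ncard = 3

/-- A proper 3-edge-colouring: edges sharing an endpoint get different colours. -/
def Colourable3 (G : SimpleGraph V) : Prop :=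
  ∃ c : Sym2 V → Fin 3, ∀ e₁ ∈ G.edgeSet, ∀ e₂ ∈ G.edgeSet,
    e₁ ≠ e₂ → (∃ v, v ∈ e₁ ∧ v ∈ e₂) → c e₁ ≠ c e₂

/-- A subgraph is 2-regular if every one of its vertices has exactly two neighbours in it. -/
def IsTwoRegular {G : SimpleGraph V} (H : G.Subgraph) : Prop :=
  ∀ v ∈ H.verts, (H.neighborSet v).ncard = 2

/-- A cycle is a connected 2-regular subgraph. -/
def IsCycleSub {G : SimpleGraph V} (C : G.Subgraph) : Prop :=
  C.Connected ∧ IsTwoRegular C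

/-- A 2-factor is a spanning 2-regular subgraph. -/
def IsTwoFactor {G : SimpleGraph V} (F : G.Subgraph) : Prop :=
  F.IsSpanning ∧ IsTwoRegular F

/-- A 2-factor is even if all its cycles (connected components) have even length. -/
def IsEvenTwoFactor {G : SimpleGraph V} (F : G.Subgraph) : Prop :=
  IsTwoFactor F ∧ ∀ C : G.Subgraph, C ≤ F → IsCycleSub C → Even C.verts.ncard

/-- An even subgraph: every vertex has even degree. -/
def IsEvenSubgraph {G : SimpleGraph V} (H : G.Subgraph) : Prop :=
  ∀ v : V, Even (H.neighborSet v).ncard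

/-- A cycle double cover: a multiset of cycles covering each edge exactly twice. -/
def IsCDC (G : SimpleGraph V) (D : Multiset G.Subgraph) : Prop :=
  (∀ C ∈ D, IsCycleSub C) ∧
  ∀ e ∈ G.edgeSet, D.countP (fun C => e ∈ C.edgeSet) = 2

/-- A k-CDC, seen as a multiset of k even subgraphs covering each edge exactly twice. -/
def IsKCDC (G : SimpleGraph V) (k : ℕ) (D : Multiset G.Subgraph) : Prop :=
  D.card = k ∧ (∀ H ∈ D, IsEvenSubgraph H) ∧
  ∀ e ∈ G.edgeSet, D.countP (fun H => e ∈ H.edgeSet) = 2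

/-- An edge set is even if every vertex meets an even number of its edges. -/
def EvenEdgeSet (S : Set (Sym2 V)) : Prop :=
  ∀ v : V, Even {w : V | s(v, w) ∈ S}.ncard

/-- A k-CDC presented as a multiset of k even edge sets covering each edge exactly twice. -/
def IsKCDCEdgeSets (G : SimpleGraph V) (k : ℕ) (D : Multiset (Set (Sym2 V))) : Prop :=
  D.card = k ∧ (∀ S ∈ D, S ⊆ G.edgeSet ∧ EvenEdgeSet S) ∧
  ∀ e ∈ G.edgeSet, D.countP (fun S => e ∈ S) = 2

/-- The set A contains (the vertices of) a cycle of G. -/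
def HasCycleIn (G : SimpleGraph V) (A : Set V) : Prop :=
  ∃ C : G.Subgraph, IsCycleSub C ∧ C.verts ⊆ A

/-- The edges of G crossing between A and its complement. -/
def cutEdges (G : SimpleGraph V) (A : Set V) : Set (Sym2 V) :=
  {e ∈ G.edgeSet | ∃ x ∈ A, ∃ y ∉ A, e = s(x, y)}

/-- Cyclically k-edge-connected: every edge cut separating two cycles has at least k edges. -/
def CyclEdgeConn (G : SimpleGraph V) (k : ℕ) : Prop :=
  ∀ A : Set V, HasCycleIn G A → HasCycleIn G Aᶜ → k ≤ (cutEdges G A).ncard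

/-- A snark: an uncolourable cyclically 4-edge-connected cubic graph with girth at least 5. -/
def IsSnark (G : SimpleGraph V) : Prop :=
  IsCubic G ∧ ¬ Colourable3 G ∧ CyclEdgeConn G 4 ∧ 5 ≤ G.girth

/-- The edge-insertion operation applied to the edges ab and cd of G: subdivide each with a
new vertex (u = inr 0, v = inr 1) and join the two new vertices by an edge. -/
def edgeInsertion (G : SimpleGraph V) (a b c d : V) : SimpleGraph (V ⊕ Fin 2) :=
  SimpleGraph.fromEdgeSet
    ((Sym2.map Sum.inl '' (G.edgeSet \ {s(a, b), s(c, d)})) ∪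
      {s(Sum.inl a, Sum.inr 0), s(Sum.inr 0, Sum.inl b),
       s(Sum.inl c, Sum.inr 1), s(Sum.inr 1, Sum.inl d),
       s(Sum.inr 0, Sum.inr 1)})

/-- A permutation graph: a cubic graph with a 2-factor consisting of two induced cycles. -/
def IsPermutationGraph (G : SimpleGraph V) : Prop :=
  IsCubic G ∧ ∃ C₁ C₂ : G.Subgraph, IsCycleSub C₁ ∧ IsCycleSub C₂ ∧
    C₁.IsInduced ∧ C₂.IsInduced ∧ Disjoint C₁.verts C₂.verts ∧ IsTwoFactor (C₁ ⊔ C₂)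

/-- The total weight of the edge cut determined by A. -/
noncomputable def cutWeight (G : SimpleGraph V) (w : Sym2 V → ℕ) (A : Set V) : ℕ :=
  ∑ᶠ e ∈ cutEdges G A, w e

/-- An eulerian (1,2)-weight: each edge gets weight 1 or 2 and every edge cut has even weight. -/
def IsEulerianWeight (G : SimpleGraph V) (w : Sym2 V → ℕ) : Prop :=
  (∀ e ∈ G.edgeSet, w e = 1 ∨ w e = 2) ∧ ∀ A : Set V, Even (cutWeight G w A)

/-- A compatible cycle cover of (G, w): each edge e lies in exactly w(e) of the cycles. -/
def IsCompatibleCycleCover (G : SimpleGraph V) (w : Sym2 V → ℕ)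
    (D : Multiset G.Subgraph) : Prop :=
  (∀ C ∈ D, IsCycleSub C) ∧
  ∀ e ∈ G.edgeSet, D.countP (fun C => e ∈ C.edgeSet) = w e


/-- In a cycle walk, positions of equal vertices agree modulo the length. -/
lemma cyc_pos {W : Type*} {H : SimpleGraph W} {u : W} {p : H.Walk u u} (hp : p.IsCycle)
    {i j : ℕ} (hi : i ≤ p.length) (hj : j ≤ p.length) (h : p.getVert i = p.getVert j) :
    i = j ∨ (i = 0 ∧ j = p.length) ∨ (j = 0 ∧ i = p.length) := by
  have h3 := hp.three_le_length
  have h0 : p.getVert p.length = p.getVert 0 := by simp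
  by_cases hi' : i = p.length
  · by_cases hj' : j = p.length
    · omega
    · have := hp.getVert_injOn' (x₁ := 0) (x₂ := j) (by simp) (by simp; omega) (by
        rw [← h, hi', h0])
      omega
  · by_cases hj' : j = p.length
    · have := hp.getVert_injOn' (x₁ := 0) (x₂ := i) (by simp) (by simp; omega) (by
        rw [h, hj', h0])
      omega
    · exact Or.inl (hp.getVert_injOn' (by simp; omega) (by simp; omega) h)

lemma cyc_edge_inj {W : Type*} {H : SimpleGraph W} {u : W} {p : H.Walk u u} (hp : p.IsCycle)
    {i j : ℕ} (hi : i < p.length) (hj : j < p.length)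
    (h : s(p.getVert i, p.getVert (i + 1)) = s(p.getVert j, p.getVert (j + 1))) : i = j := by
  have h3 := hp.three_le_length
  rw [Sym2.eq_iff] at h
  rcases h with ⟨h1, -⟩ | ⟨h1, h2⟩
  · have := cyc_pos hp hi.le hj.le h1
    omega
  · have a1 := cyc_pos hp hi.le hj h1
    have a2 := cyc_pos hp hi hj.le h2
    omega

/-- Two distinct edges of an even cycle that share a vertex have positions of different parity. -/
lemma cyc_edge_parity {W : Type*} {H : SimpleGraph W} {u : W} {p : H.Walk u u} (hp : p.IsCycle)
    (hev : Even p.length)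
    {i j : ℕ} (hi : i < p.length) (hj : j < p.length) {v w w' : W} (hw : w ≠ w')
    (h : s(p.getVert i, p.getVert (i + 1)) = s(v, w))
    (h' : s(p.getVert j, p.getVert (j + 1)) = s(v, w')) : (Even i ↔ ¬ Even j) := by
  have h3 := hp.three_le_length
  have hij : i ≠ j := by
    rintro rfl
    rw [h, Sym2.congr_right] at h'
    exact hw h'
  have hv : p.getVert i = p.getVert j ∨ p.getVert i = p.getVert (j + 1) ∨
      p.getVert (i + 1) = p.getVert j ∨ p.getVert (i + 1) = p.getVert (j + 1) := by
    rw [Sym2.eq_iff] at h h'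
    grind
  have key : i = j + 1 ∨ j = i + 1 ∨ (i = 0 ∧ j + 1 = p.length) ∨ (j = 0 ∧ i + 1 = p.length) := by
    rcases hv with hv | hv | hv | hv
    · have := cyc_pos hp hi.le hj.le hv
      omega
    · have := cyc_pos hp hi.le hj hv
      omega
    · have := cyc_pos hp hi hj.le hv
      omega
    · have := cyc_pos hp hi hj hv
      omega
  rw [Nat.even_iff] at *
  rw [Nat.even_iff]
  omega

/-- A finite 2-regular graph all of whose cycles are even has a proper 2-edge-colouring. -/
lemma exists_two_colouring {W : Type*} [Finite W] {H : SimpleGraph W}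
    (hH : ∀ v, (H.neighborSet v).ncard = 2)
    (hev : ∀ (u : W) (p : H.Walk u u), p.IsCycle → Even p.length) :
    ∃ col : Sym2 W → Prop, ∀ v w w', H.Adj v w → H.Adj v w' → w ≠ w' →
      (col s(v, w) ↔ ¬ col s(v, w')) := by
  have : H.LocallyFinite := fun v => Fintype.ofFinite _
  have hcyc : H.IsCycles := fun v _ => hH v
  have hex : ∀ K : H.ConnectedComponent, ∃ (u : W) (p : H.Walk u u),
      p.IsCycle ∧ p.toSubgraph.verts = K.supp := by
    intro K
    obtain ⟨v, hv⟩ := K.nonempty_supp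
    obtain ⟨p, hp⟩ := hcyc.exists_cycle_toSubgraph_verts_eq_connectedComponentSupp hv
      (Set.nonempty_of_ncard_ne_zero (by rw [hH]; norm_num))
    exact ⟨v, p, hp⟩
  choose u p hp hK using hex
  have hpos : ∀ v w, H.Adj v w → ∃ i, i < (p (H.connectedComponentMk v)).length ∧
      s((p (H.connectedComponentMk v)).getVert i, (p (H.connectedComponentMk v)).getVert (i + 1))
        = s(v, w) := by
    intro v w hvw
    have hv : v ∈ (p (H.connectedComponentMk v)).toSubgraph.verts := by
      rw [hK]; simp
    have := ((hp _).adj_toSubgraph_iff_of_isCycles hcyc hv w).2 hvw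
    rw [SimpleGraph.Walk.toSubgraph_adj_iff] at this
    obtain ⟨i, h1, h2⟩ := this
    exact ⟨i, h2, h1⟩
  have hmem : ∀ K i, H.connectedComponentMk ((p K).getVert i) = K := by
    intro K i
    have : (p K).getVert i ∈ (p K).toSubgraph.verts := by simp
    rw [hK] at this
    exact this
  let col : Sym2 W → Prop := fun e => ∃ K i, i < (p K).length ∧ Even i ∧
    s((p K).getVert i, (p K).getVert (i + 1)) = e
  have hcol : ∀ v w i, i < (p (H.connectedComponentMk v)).length →
      s((p (H.connectedComponentMk v)).getVert i, (p (H.connectedComponentMk v)).getVert (i + 1))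
        = s(v, w) → (col s(v, w) ↔ Even i) := by
    intro v w i hi hvw
    constructor
    · rintro ⟨K, j, hj, hje, h⟩
      have hKv : K = H.connectedComponentMk v := by
        have := Sym2.eq_iff.1 h
        rcases this with ⟨h, -⟩ | ⟨-, h⟩
        · rw [← h, hmem]
        · rw [← h, hmem]
      subst hKv
      rwa [cyc_edge_inj (hp _) hi hj (hvw.trans h.symm)]
    · intro he
      exact ⟨_, i, hi, he, hvw⟩
  refine ⟨col, fun v w w' hw hw' hne => ?_⟩
  obtain ⟨i, hi, h⟩ := hpos v w hw
  obtain ⟨j, hj, h'⟩ := hpos v w' hw'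
  rw [hcol v w i hi h, hcol v w' j hj h']
  exact (cyc_edge_parity (hp _) (hev _ _ (hp _)) hi hj hne h h' : Even i ↔ ¬ Even j)

/-- A set closed under adjacency is closed under reachability. -/
lemma mem_of_reachable {W : Type*} {H : SimpleGraph W} {S : Set W}
    (hS : ∀ x y, H.Adj x y → x ∈ S → y ∈ S) {x y : W} (h : H.Reachable x y) (hx : x ∈ S) :
    y ∈ S := by
  obtain ⟨p⟩ := h
  induction p with
  | nil => exact hx
  | cons hadj _ ih => exact ih (hS _ _ hadj hx)

/-- Two edges on the same cycle of a 2-regular graph form an edge cut. -/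
lemma exists_cut {W : Type*} [Finite W] {H : SimpleGraph W} (hcyc : H.IsCycles)
    {a b c d : W} (hab : H.Adj a b) (hcd : H.Adj c d) (hne : s(a, b) ≠ s(c, d))
    (hr : H.Reachable c a) :
    ∃ S : Set W, (a ∈ S ↔ b ∉ S) ∧ (c ∈ S ↔ d ∉ S) ∧
      ∀ x y, H.Adj x y → s(x, y) ≠ s(a, b) → s(x, y) ≠ s(c, d) → (x ∈ S ↔ y ∈ S) := by
  have : H.LocallyFinite := fun v => Fintype.ofFinite _
  set H1 := H.deleteEdges {s(a, b)} with hH1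
  set H2 := H1.deleteEdges {s(c, d)} with hH2
  have hle : H1 ≤ H := SimpleGraph.deleteEdges_le _
  have hbr : ¬ H2.Reachable c d := by
    rw [hH2, ← SimpleGraph.isBridge_iff, SimpleGraph.isBridge_iff_forall_cycle_notMem
      (by simp [hH1, hcd, hne.symm])]
    intro u p hp hmem
    have hab1 : s(a, b) ∉ (p.mapLe hle).edges := by
      intro h
      rw [SimpleGraph.Walk.edges_mapLe_eq_edges] at h
      have := p.edges_subset_edgeSet h
      simp [hH1] at this
    have hp' : (p.mapLe hle).IsCycle := (SimpleGraph.Walk.isCycle_mapLe hle).2 hp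
    have hc : c ∈ (p.mapLe hle).toSubgraph.verts := by
      rw [SimpleGraph.Walk.mem_verts_toSubgraph]
      apply SimpleGraph.Walk.fst_mem_support_of_mem_edges (p.mapLe hle) (u := d)
      rw [SimpleGraph.Walk.edges_mapLe_eq_edges]
      exact hmem
    have ha : a ∈ (p.mapLe hle).toSubgraph.verts := by
      refine mem_of_reachable (fun x y hxy hx => ?_) hr hc
      exact ((hp'.adj_toSubgraph_iff_of_isCycles hcyc hx y).2 hxy).snd_mem
    have := (hp'.adj_toSubgraph_iff_of_isCycles hcyc ha b).2 hab
    rw [SimpleGraph.Walk.adj_toSubgraph_iff_mem_edges] at this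
    exact hab1 this
  let S : Set W := {x | H2.Reachable c x}
  have hclosed : ∀ x y, H.Adj x y → s(x, y) ≠ s(a, b) → s(x, y) ≠ s(c, d) → x ∈ S → y ∈ S := by
    intro x y hxy h1 h2 hx
    have : H2.Adj x y := by
      simp only [hH2, hH1, SimpleGraph.deleteEdges_adj, Set.mem_singleton_iff]
      exact ⟨⟨hxy, h1⟩, h2⟩
    exact hx.trans this.reachable
  have hcS : c ∈ S := SimpleGraph.Reachable.refl _
  have hdS : d ∉ S := hbr
  refine ⟨S, ?_, by simp [hcS, hdS], fun x y hxy h1 h2 => ⟨hclosed x y hxy h1 h2,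
    hclosed y x hxy.symm (by rwa [Sym2.eq_swap]) (by rwa [Sym2.eq_swap])⟩⟩
  by_contra hcon
  have hiff : a ∈ S ↔ b ∈ S := by tauto
  apply hdS
  refine mem_of_reachable (fun x y hxy hx => ?_) (hcyc.reachable_deleteEdges hcd) hcS
  simp only [SimpleGraph.deleteEdges_adj, Set.mem_singleton_iff] at hxy
  by_cases h1 : s(x, y) = s(a, b)
  · rcases Sym2.eq_iff.1 h1 with ⟨rfl, rfl⟩ | ⟨rfl, rfl⟩ <;> tauto
  · exact hclosed x y hxy.1 h1 hxy.2 hx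

/-- Colourability from a function on ordered pairs. -/
lemma colourable_of_fun {W : Type*} {G : SimpleGraph W} (f : W → W → Fin 3)
    (hs : ∀ x y, G.Adj x y → f x y = f y x)
    (hf : ∀ x y z, G.Adj x y → G.Adj x z → y ≠ z → f x y ≠ f x z) : Colourable3 G := by
  have hc : ∀ x y, G.Adj x y → f (Quot.out s(x, y)).1 (Quot.out s(x, y)).2 = f x y := by
    intro x y hxy
    have : s((Quot.out s(x, y)).1, (Quot.out s(x, y)).2) = s(x, y) := Quot.out_eq s(x, y)
    rcases Sym2.eq_iff.1 this with ⟨h1, h2⟩ | ⟨h1, h2⟩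
    · rw [h1, h2]
    · rw [h1, h2, hs x y hxy]
  refine ⟨fun e => f (Quot.out e).1 (Quot.out e).2, ?_⟩
  rintro e₁ h₁ e₂ h₂ hne ⟨v, hv1, hv2⟩
  obtain ⟨y, rfl⟩ := hv1
  obtain ⟨z, rfl⟩ := hv2
  rw [SimpleGraph.mem_edgeSet] at h₁ h₂
  show f _ _ ≠ f _ _
  rw [hc _ _ h₁, hc _ _ h₂]
  exact hf v y z h₁ h₂ (fun h => hne (by rw [h]))

/-- A cycle walk of `F` viewed in `G` yields an even length. -/
lemma even_of_isCycle {V : Type*} {G : SimpleGraph V} {F : G.Subgraph} (hF : IsEvenTwoFactor F)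
    (u : V) (p : F.spanningCoe.Walk u u) (hp : p.IsCycle) : Even p.length := by
  have hle : F.spanningCoe ≤ G := F.spanningCoe_le
  have hp' : (p.mapLe hle).IsCycle := (SimpleGraph.Walk.isCycle_mapLe hle).2 hp
  have h := hF.2 (p.mapLe hle).toSubgraph ?_ ⟨(p.mapLe hle).toSubgraph_connected, ?_⟩
  · have hverts : (p.mapLe hle).toSubgraph.verts = ((p.mapLe hle).support.tail.toFinset : Set V) := by
      ext x
      simp only [SimpleGraph.Walk.mem_verts_toSubgraph, List.coe_toFinset, Set.mem_ofPred_eq]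
      rw [SimpleGraph.Walk.mem_support_iff]
      constructor
      · rintro (rfl | h)
        · exact SimpleGraph.Walk.end_mem_tail_support hp'.not_nil
        · exact h
      · exact Or.inr
    rw [hverts, Set.ncard_coe_finset, List.toFinset_card_of_nodup hp'.support_nodup] at h
    simpa using h
  · refine ⟨fun x _ => hF.1.1 x, fun x y hxy => ?_⟩
    rw [SimpleGraph.Walk.adj_toSubgraph_iff_mem_edges,
      SimpleGraph.Walk.edges_mapLe_eq_edges] at hxy
    exact p.edges_subset_edgeSet hxy
  · intro v hv
    exact hp'.ncard_neighborSet_toSubgraph_eq_two (by simpa using hv)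

/-- At a vertex of a cubic graph only one edge avoids the 2-factor. -/
lemma eq_of_not_adj {V : Type*} [Finite V] {G : SimpleGraph V} (hG : IsCubic G) {F : G.Subgraph}
    (hF : ∀ v, (F.neighborSet v).ncard = 2) {x y z : V} (hy : G.Adj x y) (hz : G.Adj x z)
    (hy' : ¬ F.Adj x y) (hz' : ¬ F.Adj x z) : y = z := by
  have h1 : (G.neighborSet x \ F.neighborSet x).ncard = 1 := by
    rw [Set.ncard_sdiff (F.neighborSet_subset x), hG, hF]
  obtain ⟨t, ht⟩ := Set.ncard_eq_one.1 h1
  have a1 : y ∈ G.neighborSet x \ F.neighborSet x := ⟨hy, hy'⟩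
  have a2 : z ∈ G.neighborSet x \ F.neighborSet x := ⟨hz, hz'⟩
  rw [ht] at a1 a2
  exact a1.trans a2.symm

/-- The colour of a 2-factor edge. -/
noncomputable def bcol (P : Prop) : Fin 3 := if P then 0 else 1

lemma bcol_ne {P Q : Prop} (h : P ↔ ¬ Q) : bcol P ≠ bcol Q := by
  unfold bcol
  by_cases hQ : Q <;> simp [h, hQ]

lemma bcol_ne_two (P : Prop) : bcol P ≠ 2 := by
  unfold bcol
  split_ifs <;> decide

/-- inserting an edge between two disjoint edges lying on the same cycle of an
even 2-factor yields a colourable graph. -/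
theorem edgeInsertion_colourable_of_even_two_factor {V : Type*} [Fintype V]
    (G : SimpleGraph V) (hG : IsCubic G)
    (F : G.Subgraph) (hF : IsEvenTwoFactor F)
    (a b c d : V) (hab : G.Adj a b) (hcd : G.Adj c d)
    (hac : a ≠ c) (had : a ≠ d) (hbc : b ≠ c) (hbd : b ≠ d)
    (C : G.Subgraph) (hCF : C ≤ F) (hC : IsCycleSub C)
    (he : s(a, b) ∈ C.edgeSet) (he' : s(c, d) ∈ C.edgeSet) :
    Colourable3 (edgeInsertion G a b c d) := by
  have hF2 : ∀ v, (F.neighborSet v).ncard = 2 := fun v => hF.1.2 v (hF.1.1 v)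
  have hH2 : ∀ v, (F.spanningCoe.neighborSet v).ncard = 2 := hF2
  have hcyc : F.spanningCoe.IsCycles := fun v _ => hH2 v
  have hCab : C.Adj a b := he
  have hCcd : C.Adj c d := he'
  have hFab : F.Adj a b := hCF.2 hCab
  have hFcd : F.Adj c d := hCF.2 hCcd
  have hne : s(a, b) ≠ s(c, d) := by
    intro h
    rcases Sym2.eq_iff.1 h with ⟨h, -⟩ | ⟨h, -⟩
    · exact hac h
    · exact had h
  have hr : F.spanningCoe.Reachable c a := by
    have h := hC.1.preconnected ⟨c, hCcd.fst_mem⟩ ⟨a, hCab.fst_mem⟩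
    let φ : C.coe →g F.spanningCoe := ⟨fun x => x.1, fun h => hCF.2 h⟩
    exact h.map φ
  obtain ⟨col, hcol⟩ := exists_two_colouring hH2 (even_of_isCycle hF)
  obtain ⟨S, hSab, hScd, hS⟩ := exists_cut hcyc (a := a) (b := b) (c := c) (d := d)
    hFab hFcd hne hr
  let g : V → V → Fin 3 := fun x y =>
    if F.Adj x y then bcol (col s(x, y) ↔ x ∈ S) else 2
  have hg : ∀ x y z, G.Adj x y → G.Adj x z → y ≠ z → g x y ≠ g x z := by
    intro x y z hy hz hyz
    simp only [g]
    by_cases h1 : F.Adj x y <;> by_cases h2 : F.Adj x z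
    · rw [if_pos h1, if_pos h2]
      have := hcol x y z h1 h2 hyz
      exact bcol_ne (by tauto)
    · rw [if_pos h1, if_neg h2]
      exact bcol_ne_two _
    · rw [if_neg h1, if_pos h2]
      exact (bcol_ne_two _).symm
    · exact absurd (eq_of_not_adj hG hF2 hy hz h1 h2) hyz
  let e : Fin 2 → Sym2 V := fun i => if i = 0 then s(a, b) else s(c, d)
  let f : V ⊕ Fin 2 → V ⊕ Fin 2 → Fin 3 := fun x y => match x, y with
    | .inl x, .inl y => g x y
    | .inl x, .inr i => bcol (col (e i) ↔ x ∈ S)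
    | .inr i, .inl x => bcol (col (e i) ↔ x ∈ S)
    | .inr _, .inr _ => 2
  -- adjacency in the new graph
  have adj_ll : ∀ x y, (edgeInsertion G a b c d).Adj (.inl x) (.inl y) →
      G.Adj x y ∧ s(x, y) ≠ s(a, b) ∧ s(x, y) ≠ s(c, d) := by
    intro x y h
    simp only [edgeInsertion, SimpleGraph.fromEdgeSet_adj] at h
    rcases h.1 with ⟨t, ⟨ht, ht'⟩, h⟩ | h
    · rw [← Sym2.map_mk] at h
      have := Sym2.map.injective Sum.inl_injective h
      subst this
      simp only [Set.mem_insert_iff, Set.mem_singleton_iff, not_or] at ht'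
      exact ⟨ht, ht'⟩
    · simp at h
  have adj_lr : ∀ x i, (edgeInsertion G a b c d).Adj (.inl x) (.inr i) →
      ∃ y, s(x, y) = e i ∧ F.Adj x y := by
    intro x i h
    simp only [edgeInsertion, SimpleGraph.fromEdgeSet_adj] at h
    rcases h.1 with ⟨t, ⟨ht, ht'⟩, h⟩ | h
    · induction t with | h p q => simp at h
    · fin_cases i
      · simp at h
        rcases h with rfl | rfl
        · exact ⟨b, by simp [e], hFab⟩
        · exact ⟨a, by simp [e, Sym2.eq_swap], hFab.symm⟩
      · simp at h
        rcases h with rfl | rfl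
        · exact ⟨d, by simp [e], hFcd⟩
        · exact ⟨c, by simp [e, Sym2.eq_swap], hFcd.symm⟩
  -- neighbours of an old vertex in the new graph correspond to its old neighbours
  have key : ∀ x w, (edgeInsertion G a b c d).Adj (.inl x) w → ∃ y, G.Adj x y ∧
      f (.inl x) w = g x y ∧
      w = (if s(x, y) = s(a, b) then .inr 0 else if s(x, y) = s(c, d) then .inr 1 else .inl y) := by
    rintro x (y | i) h
    · obtain ⟨h1, h2, h3⟩ := adj_ll x y h
      exact ⟨y, h1, rfl, by rw [if_neg h2, if_neg h3]⟩
    · obtain ⟨y, h1, h2⟩ := adj_lr x i h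
      refine ⟨y, h2.adj_sub, ?_, ?_⟩
      · simp only [f, g]
        rw [if_pos h2, h1]
      · rw [h1]
        fin_cases i
        · simp [e]
        · simp [e, hne.symm]
  -- the new vertices
  have split : ∀ i x y, (edgeInsertion G a b c d).Adj (.inr i) (.inl x) →
      (edgeInsertion G a b c d).Adj (.inr i) (.inl y) → x ≠ y → (x ∈ S ↔ y ∉ S) := by
    intro i x y hx hy hxy
    obtain ⟨x', h1, -⟩ := adj_lr x i hx.symm
    obtain ⟨y', h2, -⟩ := adj_lr y i hy.symm
    fin_cases i
    · simp [e] at h1 h2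
      grind
    · simp [e] at h1 h2
      grind
  refine colourable_of_fun f ?_ ?_
  · rintro (x | i) (y | j) h
    · obtain ⟨h1, h2, h3⟩ := adj_ll x y h
      simp only [f, g]
      by_cases hxy : F.Adj x y
      · rw [if_pos hxy, if_pos hxy.symm, Sym2.eq_swap, hS x y hxy h2 h3]
      · rw [if_neg hxy, if_neg (fun h => hxy h.symm)]
    · rfl
    · rfl
    · rfl
  · rintro (x | i) w w' h h' hww
    · obtain ⟨y, h1, h2, h3⟩ := key x w h
      obtain ⟨z, h1', h2', h3'⟩ := key x w' h'
      rw [h2, h2']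
      refine hg x y z h1 h1' ?_
      rintro rfl
      exact hww (h3.trans h3'.symm)
    · rcases w with y | j <;> rcases w' with z | k
      · have := split i y z h h' (fun h => hww (by rw [h]))
        simp only [f]
        exact bcol_ne (by tauto)
      · exact bcol_ne_two _
      · exact (bcol_ne_two _).symm
      · exfalso
        have n1 : i ≠ j := fun h0 => h.ne (by rw [h0])
        have n2 : i ≠ k := fun h0 => h'.ne (by rw [h0])
        exact hww (by congr 1; omega)

end SnarkPaper
end

section
/- Let G be a colourable cubic graph and let G' be obtained from G by applying the edge-insertion operation to two disjoint edges e and e'. If the new edge uv (joining the two new subdivision vertices) lies on a 4-cycle of G', then G' is colourable. -/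
open scoped Classical

namespace SnarkPaper

variable {V : Type*}

lemma exists_nbr (G : SimpleGraph V) (hG : IsCubic G) (φ : Sym2 V → Fin 3)
    (hφ : ∀ v x y, G.Adj v x → G.Adj v y → x ≠ y → φ s(v, x) ≠ φ s(v, y)) :
    ∃ n : V → Fin 3 → V, (∀ v i, G.Adj v (n v i)) ∧ (∀ v i, φ s(v, n v i) = i) ∧
      ∀ v w, G.Adj v w → w = n v (φ s(v, w)) := by
  have key : ∀ v i, ∃ w, G.Adj v w ∧ φ s(v, w) = i := by
    intro v i
    have hinj : Set.InjOn (fun w => φ s(v, w)) (G.neighborSet v) := by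
      intro x hx y hy hxy
      by_contra hne
      exact hφ v x y hx hy hne hxy
    have hc := hinj.ncard_image
    rw [hG v] at hc
    have huniv : (fun w => φ s(v, w)) '' (G.neighborSet v) = Set.univ := by
      apply Set.eq_of_subset_of_ncard_le (Set.subset_univ _)
      rw [hc, Set.ncard_univ]; simp
    have : i ∈ (fun w => φ s(v, w)) '' (G.neighborSet v) := by rw [huniv]; trivial
    obtain ⟨w, hw, hi⟩ := this
    exact ⟨w, hw, hi⟩
  choose n hn1 hn2 using key
  refine ⟨n, hn1, hn2, ?_⟩
  intro v w h
  by_contra hne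
  exact hφ v w _ h (hn1 v _) hne (hn2 v _).symm

lemma colourable3_iff {W : Type*} (G : SimpleGraph W) (c : Sym2 W → Fin 3) :
    (∀ e₁ ∈ G.edgeSet, ∀ e₂ ∈ G.edgeSet,
      e₁ ≠ e₂ → (∃ v, v ∈ e₁ ∧ v ∈ e₂) → c e₁ ≠ c e₂) ↔
    ∀ v x y, G.Adj v x → G.Adj v y → x ≠ y → c s(v, x) ≠ c s(v, y) := by
  constructor
  · intro h v x y hx hy hne
    refine h _ hx _ hy ?_ ⟨v, by simp, by simp⟩
    intro h'
    exact hne (Sym2.congr_right.1 h')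
  · rintro h e₁ h₁ e₂ h₂ hne ⟨v, hv₁, hv₂⟩
    obtain ⟨x, rfl⟩ := hv₁
    obtain ⟨y, rfl⟩ := hv₂
    refine h v x y h₁ h₂ ?_
    rintro rfl
    exact hne rfl

/-- In a finite graph with degrees at most two, a component containing a vertex of degree one
contains exactly two of them. -/
lemma two_ends [Fintype V] (H : SimpleGraph V) (T : Finset V)
    (h1 : ∀ v ∈ T, (H.neighborSet v).ncard = 1) (h2 : ∀ v ∉ T, (H.neighborSet v).ncard = 2)
    (a : V) (ha : a ∈ T) : (T.filter (fun v => H.Reachable a v)).card = 2 := by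
  set K := H.connectedComponentMk a with hK
  have hmem : ∀ v, v ∈ K.supp ↔ H.Reachable a v := by
    intro v
    rw [SimpleGraph.ConnectedComponent.mem_supp_iff, hK, SimpleGraph.ConnectedComponent.eq]
    exact SimpleGraph.reachable_comm
  have hconn : (H.induce K.supp).Connected := K.connected_toSimpleGraph
  have hle := hconn.card_vert_le_card_edgeSet_add_one
  have hsum := (H.induce K.supp).sum_degrees_eq_twice_card_edges
  have hdeg : ∀ v : K.supp, (H.induce K.supp).degree v = if (v : V) ∈ T then 1 else 2 := by
    intro v
    have : (H.induce K.supp).degree v = (H.neighborSet v).ncard := by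
      rw [← SimpleGraph.card_neighborSet_eq_degree, ← Nat.card_eq_fintype_card]
      rw [← Nat.card_coe_set_eq]
      apply Nat.card_congr
      refine ⟨fun w => ⟨w.1.1, w.2⟩, fun w => ⟨⟨w.1, ?_⟩, w.2⟩, fun _ => rfl, fun _ => rfl⟩
      have hv := (hmem _).1 v.2
      exact (hmem _).2 (hv.trans (SimpleGraph.Adj.reachable w.2))
    rw [this]
    split_ifs with h
    · exact h1 _ h
    · exact h2 _ h
  have hs2 : ∑ v : K.supp, (H.induce K.supp).degree v + (T.filter (fun v => H.Reachable a v)).card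
      = 2 * Fintype.card K.supp := by
    have e1 : (T.filter (fun v => H.Reachable a v)).card
        = ∑ v : K.supp, if (v : V) ∈ T then 1 else 0 := by
      rw [Finset.sum_boole]
      simp only [Nat.cast_id]
      symm
      apply Finset.card_bij (fun (v : K.supp) _ => (v : V))
      · intro v hv
        simp only [Finset.mem_filter, Finset.mem_univ, true_and] at hv ⊢
        exact ⟨hv, (hmem _).1 v.2⟩
      · intro v _ w _ h
        exact Subtype.ext h
      · intro v hv
        simp only [Finset.mem_filter] at hv
        exact ⟨⟨v, (hmem _).2 hv.2⟩, by simpa using hv.1, rfl⟩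
    rw [e1, ← Finset.sum_add_distrib]
    rw [Finset.sum_congr rfl (g := fun _ => 2)]
    · simp [mul_comm]
    · intro v _
      rw [hdeg]; split_ifs <;> rfl
  have hpos : 0 < (T.filter (fun v => H.Reachable a v)).card :=
    Finset.card_pos.2 ⟨a, by simp [ha]⟩
  rw [Nat.card_eq_fintype_card, Nat.card_eq_fintype_card] at hle
  rw [SimpleGraph.edgeFinset_card] at hsum
  omega

lemma adj_ll (G : SimpleGraph V) (a b c d x y : V) :
    (edgeInsertion G a b c d).Adj (Sum.inl x) (Sum.inl y) ↔
      G.Adj x y ∧ s(x, y) ≠ s(a, b) ∧ s(x, y) ≠ s(c, d) := by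
  have h : ∀ S : Set (Sym2 V), s((Sum.inl x : V ⊕ Fin 2), Sum.inl y) ∈ Sym2.map Sum.inl '' S ↔
      s(x, y) ∈ S := by
    intro S
    rw [← Sym2.map_mk]
    exact (Sym2.map.injective Sum.inl_injective).mem_set_image
  rw [edgeInsertion, SimpleGraph.fromEdgeSet_adj, Set.mem_union, h]
  simp only [Set.mem_sdiff, SimpleGraph.mem_edgeSet, Set.mem_insert_iff, Set.mem_singleton_iff]
  constructor
  · rintro ⟨h | h, h'⟩
    · tauto
    · simp at h
  · rintro ⟨h1, h2, h3⟩
    refine ⟨Or.inl ⟨h1, by tauto⟩, ?_⟩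
    intro h
    exact h1.ne (Sum.inl_injective h)

lemma adj_l0 (G : SimpleGraph V) (a b c d x : V) :
    (edgeInsertion G a b c d).Adj (Sum.inl x) (Sum.inr 0) ↔ x = a ∨ x = b := by
  have h : ∀ S : Set (Sym2 V), s((Sum.inl x : V ⊕ Fin 2), Sum.inr 0) ∉ Sym2.map Sum.inl '' S := by
    rintro S ⟨e, -, he⟩
    induction e using Sym2.ind
    simp at he
  rw [edgeInsertion, SimpleGraph.fromEdgeSet_adj, Set.mem_union]
  simp [h]

lemma adj_l1 (G : SimpleGraph V) (a b c d x : V) :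
    (edgeInsertion G a b c d).Adj (Sum.inl x) (Sum.inr 1) ↔ x = c ∨ x = d := by
  have h : ∀ S : Set (Sym2 V), s((Sum.inl x : V ⊕ Fin 2), Sum.inr 1) ∉ Sym2.map Sum.inl '' S := by
    rintro S ⟨e, -, he⟩
    induction e using Sym2.ind
    simp at he
  rw [edgeInsertion, SimpleGraph.fromEdgeSet_adj, Set.mem_union]
  simp [h]

lemma edgeInsertion_swap1 (G : SimpleGraph V) (a b c d : V) :
    edgeInsertion G a b c d = edgeInsertion G b a c d := by
  unfold edgeInsertion
  rw [Sym2.eq_swap (a := b) (b := a), Sym2.eq_swap (a := Sum.inl b) (b := Sum.inr 0),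
    Sym2.eq_swap (a := Sum.inr 0) (b := Sum.inl a), Set.insert_comm]

lemma edgeInsertion_swap2 (G : SimpleGraph V) (a b c d : V) :
    edgeInsertion G a b c d = edgeInsertion G a b d c := by
  unfold edgeInsertion
  rw [Sym2.eq_swap (a := d) (b := c), Sym2.eq_swap (a := Sum.inl d) (b := Sum.inr 1),
    Sym2.eq_swap (a := Sum.inr 1) (b := Sum.inl c),
    Set.insert_comm (s(Sum.inl c, Sum.inr 1)) (s(Sum.inr 1, Sum.inl d))]

/-- Colour of an edge of the insertion graph, from colours of the pieces. -/
noncomputable def extFun (ψ : Sym2 V → Fin 3) (a c : V) (p q r s t : Fin 3) :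
    V ⊕ Fin 2 → V ⊕ Fin 2 → Fin 3
  | Sum.inl x, Sum.inl y => ψ s(x, y)
  | Sum.inl x, Sum.inr i => if i = 0 then (if x = a then p else q) else (if x = c then r else s)
  | Sum.inr i, Sum.inl x => if i = 0 then (if x = a then p else q) else (if x = c then r else s)
  | Sum.inr _, Sum.inr _ => t

lemma colourable_ext (G : SimpleGraph V) (a b c d : V)
    (hab : a ≠ b) (hcd : c ≠ d)
    (hac : a ≠ c) (had : a ≠ d) (hbc : b ≠ c) (hbd : b ≠ d)
    (ψ : Sym2 V → Fin 3)
    (hψ : ∀ v x y, G.Adj v x → G.Adj v y → x ≠ y → s(v, x) ≠ s(a, b) → s(v, x) ≠ s(c, d) →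
      s(v, y) ≠ s(a, b) → s(v, y) ≠ s(c, d) → ψ s(v, x) ≠ ψ s(v, y))
    (p q r s t : Fin 3) (hpq : p ≠ q) (hpt : p ≠ t) (hqt : q ≠ t)
    (hrs : r ≠ s) (hrt : r ≠ t) (hst : s ≠ t)
    (ha : ∀ x, G.Adj a x → x ≠ b → ψ s(a, x) ≠ p)
    (hb : ∀ x, G.Adj b x → x ≠ a → ψ s(b, x) ≠ q)
    (hc : ∀ x, G.Adj c x → x ≠ d → ψ s(c, x) ≠ r)
    (hd : ∀ x, G.Adj d x → x ≠ c → ψ s(d, x) ≠ s) :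
    Colourable3 (edgeInsertion G a b c d) := by
  have hsymm : ∀ x y, extFun ψ a c p q r s t x y = extFun ψ a c p q r s t y x := by
    rintro (x | i) (y | j) <;> simp [extFun, Sym2.eq_swap]
  refine ⟨Sym2.lift ⟨extFun ψ a c p q r s t, hsymm⟩, ?_⟩
  rw [colourable3_iff]
  intro v x y hx hy hne
  rw [Sym2.lift_mk, Sym2.lift_mk]
  have two : ∀ i : Fin 2, i = 0 ∨ i = 1 := by decide
  have aux0 : ∀ z w, (edgeInsertion G a b c d).Adj (Sum.inl z) (Sum.inl w) → (z = a ∨ z = b) →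
      ψ s(z, w) ≠ (if z = a then p else q) := by
    intro z w h1 h2
    rw [adj_ll] at h1
    obtain ⟨h1, h3, h4⟩ := h1
    rcases h2 with rfl | rfl
    · rw [if_pos rfl]
      exact ha _ h1 (by rintro rfl; exact h3 rfl)
    · rw [if_neg hab.symm]
      exact hb _ h1 (by rintro rfl; exact h3 Sym2.eq_swap)
  have aux1 : ∀ z w, (edgeInsertion G a b c d).Adj (Sum.inl z) (Sum.inl w) → (z = c ∨ z = d) →
      ψ s(z, w) ≠ (if z = c then r else s) := by
    intro z w h1 h2
    rw [adj_ll] at h1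
    obtain ⟨h1, h3, h4⟩ := h1
    rcases h2 with rfl | rfl
    · rw [if_pos rfl]
      exact hc _ h1 (by rintro rfl; exact h4 rfl)
    · rw [if_neg hcd.symm]
      exact hd _ h1 (by rintro rfl; exact h4 Sym2.eq_swap)
  rcases v with z | k
  · rcases x with x | i <;> rcases y with y | j
    · rw [adj_ll] at hx hy
      exact hψ z x y hx.1 hy.1 (fun h => hne (by rw [h])) hx.2.1 hx.2.2 hy.2.1 hy.2.2
    · rcases two j with rfl | rfl
      · simpa [extFun] using aux0 z x hx ((adj_l0 G a b c d z).1 hy)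
      · simpa [extFun] using aux1 z x hx ((adj_l1 G a b c d z).1 hy)
    · rcases two i with rfl | rfl
      · simpa [extFun] using (aux0 z y hy ((adj_l0 G a b c d z).1 hx)).symm
      · simpa [extFun] using (aux1 z y hy ((adj_l1 G a b c d z).1 hx)).symm
    · exfalso
      rcases two i with rfl | rfl <;> rcases two j with rfl | rfl
      · exact hne rfl
      · rw [adj_l0] at hx; rw [adj_l1] at hy; grind
      · rw [adj_l1] at hx; rw [adj_l0] at hy; grind
      · exact hne rfl
  · rcases x with x | i <;> rcases y with y | j
    · have hne' : x ≠ y := fun h => hne (by rw [h])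
      rcases two k with rfl | rfl
      · have hx := (adj_l0 G a b c d x).1 hx.symm
        have hy := (adj_l0 G a b c d y).1 hy.symm
        simp only [extFun]
        grind
      · have hx := (adj_l1 G a b c d x).1 hx.symm
        have hy := (adj_l1 G a b c d y).1 hy.symm
        simp only [extFun]
        grind
    · simp only [extFun]
      split_ifs <;> assumption
    · simp only [extFun]
      split_ifs <;> apply Ne.symm <;> assumption
    · exfalso
      have h1 := hx.ne
      have h2 := hy.ne
      rcases two i with rfl | rfl <;> rcases two j with rfl | rfl <;>
        rcases two k with rfl | rfl <;> simp at h1 h2 hne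

lemma case_same (G : SimpleGraph V) (a b c d : V) (hab : G.Adj a b) (hcd : G.Adj c d)
    (hac : a ≠ c) (had : a ≠ d) (hbc : b ≠ c) (hbd : b ≠ d) (h : G.Adj a c)
    (φ : Sym2 V → Fin 3)
    (hφ : ∀ v x y, G.Adj v x → G.Adj v y → x ≠ y → φ s(v, x) ≠ φ s(v, y))
    (heq : φ s(a, b) = φ s(c, d)) : Colourable3 (edgeInsertion G a b c d) := by
  have hk : φ s(a, c) ≠ φ s(a, b) := hφ a c b h hab hbc.symm
  obtain ⟨γ, hγ1, hγ2⟩ : ∃ γ : Fin 3, γ ≠ φ s(a, c) ∧ γ ≠ φ s(a, b) := by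
    generalize φ s(a, c) = i
    generalize φ s(a, b) = j
    revert i j; decide
  have n1 := hab.ne
  have n2 := hcd.ne
  have e1 : φ s(b, a) = φ s(a, b) := by rw [Sym2.eq_swap]
  have e2 : φ s(d, c) = φ s(c, d) := by rw [Sym2.eq_swap]
  have e3 : φ s(c, a) = φ s(a, c) := by rw [Sym2.eq_swap]
  refine colourable_ext G a b c d hab.ne hcd.ne hac had hbc hbd
    (fun e => if e = s(a, c) then φ s(a, b) else φ e) ?_ (φ s(a, c)) (φ s(a, b))
    (φ s(a, c)) (φ s(a, b)) γ hk hγ1.symm hγ2.symm hk hγ1.symm hγ2.symm ?_ ?_ ?_ ?_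
  · intro v x y hx hy hne h1 h2 h3 h4
    have hxy := hφ v x y hx hy hne
    have A1 := hφ a b x hab
    have A2 := hφ a b y hab
    have C1 := hφ c d x hcd
    have C2 := hφ c d y hcd
    simp only [ne_eq, Sym2.eq_iff] at *
    grind
  · intro x hx hxb
    have A1 := hφ a c x h hx
    simp only [ne_eq, Sym2.eq_iff] at *
    grind
  · intro x hx hxa
    have A1 := hφ b a x hab.symm hx
    simp only [ne_eq, Sym2.eq_iff] at *
    grind
  · intro x hx hxb
    have A1 := hφ c a x h.symm hx
    simp only [ne_eq, Sym2.eq_iff] at *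
    grind
  · intro x hx hxa
    have A1 := hφ d c x hcd.symm hx
    simp only [ne_eq, Sym2.eq_iff] at *
    grind

/-- The two-coloured subgraph avoiding colour `k` and the edges `ab`, `cd`. -/
def kempe (G : SimpleGraph V) (φ : Sym2 V → Fin 3) (k : Fin 3) (a b c d : V) :
    SimpleGraph V where
  Adj x y := G.Adj x y ∧ φ s(x, y) ≠ k ∧ s(x, y) ≠ s(a, b) ∧ s(x, y) ≠ s(c, d)
  symm := ⟨fun x y h => by rw [Sym2.eq_swap]; exact ⟨h.1.symm, h.2⟩⟩
  loopless := ⟨fun x h => h.1.ne rfl⟩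

lemma core [Fintype V] (G : SimpleGraph V) (hG : IsCubic G) (hcol : Colourable3 G)
    (a b c d : V) (hab : G.Adj a b) (hcd : G.Adj c d)
    (hac : a ≠ c) (had : a ≠ d) (hbc : b ≠ c) (hbd : b ≠ d) (h : G.Adj a c) :
    Colourable3 (edgeInsertion G a b c d) := by
  obtain ⟨φ, hφ⟩ := hcol
  rw [colourable3_iff] at hφ
  by_cases heq : φ s(a, b) = φ s(c, d)
  · exact case_same G a b c d hab hcd hac had hbc hbd h φ hφ heq
  obtain ⟨n, hn1, hn2, hn3⟩ := exists_nbr G hG φ hφ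
  have n1 := hab.ne
  have n2 := hcd.ne
  have e1 : φ s(b, a) = φ s(a, b) := by rw [Sym2.eq_swap]
  have e2 : φ s(d, c) = φ s(c, d) := by rw [Sym2.eq_swap]
  have e3 : φ s(c, a) = φ s(a, c) := by rw [Sym2.eq_swap]
  have hkα : φ s(a, c) ≠ φ s(a, b) := hφ a c b h hab hbc.symm
  have hkβ : φ s(a, c) ≠ φ s(c, d) := by rw [← e3]; exact hφ c a d h.symm hcd had
  have hna : b = n a (φ s(a, b)) := hn3 a b hab
  have hnb : a = n b (φ s(a, b)) := e1 ▸ hn3 b a hab.symm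
  have hnc : d = n c (φ s(c, d)) := hn3 c d hcd
  have hnd : c = n d (φ s(c, d)) := e2 ▸ hn3 d c hcd.symm
  generalize hα : φ s(a, b) = α at *
  generalize hβ : φ s(c, d) = β at *
  generalize hk : φ s(a, c) = k at *
  have tri : ∀ i : Fin 3, i = k ∨ i = α ∨ i = β := by
    intro i; revert heq hkα hkβ; clear * -; revert i α β k; decide
  set H := kempe G φ k a b c d with hH
  have hinj : ∀ v i j, n v i = n v j → i = j := by
    intro v i j hij
    rw [← hn2 v i, hij, hn2]
  -- the degrees
  have nb : ∀ v w, w ∈ H.neighborSet v ↔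
      (w = n v α ∨ w = n v β) ∧ s(v, w) ≠ s(a, b) ∧ s(v, w) ≠ s(c, d) := by
    intro v w
    constructor
    · rintro ⟨h1, h2, h3⟩
      refine ⟨?_, h3⟩
      have := hn3 v w h1
      rcases tri (φ s(v, w)) with h4 | h4 | h4
      · exact absurd h4 h2
      · left; rwa [h4] at this
      · right; rwa [h4] at this
    · rintro ⟨rfl | rfl, h3⟩
      · exact ⟨hn1 _ _, by rw [hn2]; exact hkα.symm, h3⟩
      · exact ⟨hn1 _ _, by rw [hn2]; exact hkβ.symm, h3⟩
  have nba : H.neighborSet a = {n a β} := by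
    ext w
    rw [nb, Set.mem_singleton_iff]
    have := hinj a α β
    simp only [ne_eq, Sym2.eq_iff]
    grind
  have nbb : H.neighborSet b = {n b β} := by
    ext w
    rw [nb, Set.mem_singleton_iff]
    have := hinj b α β
    simp only [ne_eq, Sym2.eq_iff]
    grind
  have nbc : H.neighborSet c = {n c α} := by
    ext w
    rw [nb, Set.mem_singleton_iff]
    have := hinj c α β
    simp only [ne_eq, Sym2.eq_iff]
    grind
  have nbd : H.neighborSet d = {n d α} := by
    ext w
    rw [nb, Set.mem_singleton_iff]
    have := hinj d α β
    simp only [ne_eq, Sym2.eq_iff]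
    grind
  have ends := two_ends H {a, b, c, d} (by
      intro v hv
      simp only [Finset.mem_insert, Finset.mem_singleton] at hv
      rcases hv with rfl | rfl | rfl | rfl
      · rw [nba, Set.ncard_singleton]
      · rw [nbb, Set.ncard_singleton]
      · rw [nbc, Set.ncard_singleton]
      · rw [nbd, Set.ncard_singleton]) (by
      intro v hv
      simp only [Finset.mem_insert, Finset.mem_singleton, not_or] at hv
      have : H.neighborSet v = {n v α, n v β} := by
        ext w
        rw [nb, Set.mem_insert_iff, Set.mem_singleton_iff]
        simp only [ne_eq, Sym2.eq_iff]
        grind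
      rw [this, Set.ncard_pair (fun h => heq (hinj v _ _ h))]) a (by simp)
  have hKstep : ∀ x y, H.Adj x y → (H.Reachable a x ↔ H.Reachable a y) := fun x y hxy =>
    ⟨fun h => h.trans hxy.reachable, fun h => h.trans hxy.symm.reachable⟩
  have hKa : H.Reachable a a := SimpleGraph.Reachable.refl a
  have cnt : (H.Reachable a b ∧ ¬ H.Reachable a c ∧ ¬ H.Reachable a d) ∨ (¬ H.Reachable a b ∧ H.Reachable a c ∧ ¬ H.Reachable a d) ∨ (¬ H.Reachable a b ∧ ¬ H.Reachable a c ∧ H.Reachable a d) := by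
    rw [Finset.filter_insert, Finset.filter_insert, Finset.filter_insert,
      Finset.filter_singleton, if_pos hKa] at ends
    by_cases h1 : H.Reachable a b <;> by_cases h2 : H.Reachable a c <;> by_cases h3 : H.Reachable a d <;>
      simp [h1, h2, h3, hac, had, hbc, hbd, n1, n2] at ends ⊢
  clear ends
  generalize hK : H.Reachable a = K at *
  have sk : Equiv.swap α β k = k := Equiv.swap_apply_of_ne_of_ne hkα hkβ
  set ψ : Sym2 V → Fin 3 := fun e => if ∃ x ∈ e, K x then Equiv.swap α β (φ e) else φ e with hψ
  have F0 : ∀ x y, (φ s(x, y) = k ∨ (K x ↔ K y)) →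
      ψ s(x, y) = if K x then Equiv.swap α β (φ s(x, y)) else φ s(x, y) := by
    intro x y hxy
    simp only [hψ, Sym2.mem_iff, exists_eq_or_imp, exists_eq_left]
    rcases hxy with hxy | hxy
    · rw [hxy, sk]; simp
    · rw [← hxy]; simp
  have F : ∀ x y, G.Adj x y → s(x, y) ≠ s(a, b) → s(x, y) ≠ s(c, d) →
      ψ s(x, y) = if K x then Equiv.swap α β (φ s(x, y)) else φ s(x, y) := by
    intro x y h1 h2 h3
    apply F0
    by_cases h4 : φ s(x, y) = k
    · exact Or.inl h4
    · exact Or.inr (hKstep x y ⟨h1, h4, h2, h3⟩)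
  have hprop : ∀ v x y, G.Adj v x → G.Adj v y → x ≠ y →
      ψ s(v, x) = (if K v then Equiv.swap α β (φ s(v, x)) else φ s(v, x)) →
      ψ s(v, y) = (if K v then Equiv.swap α β (φ s(v, y)) else φ s(v, y)) →
      ψ s(v, x) ≠ ψ s(v, y) := by
    intro v x y h1 h2 h3 h4 h5
    rw [h4, h5]
    have := hφ v x y h1 h2 h3
    split_ifs
    · exact fun h => this ((Equiv.swap α β).injective h)
    · exact this
  by_cases hKb : K b
  · -- different Kempe cycles: swap one of them
    have hKc : ¬ K c ∧ ¬ K d := by tauto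
    have F' : ∀ x y, G.Adj x y →
        ψ s(x, y) = if K x then Equiv.swap α β (φ s(x, y)) else φ s(x, y) := by
      intro x y hxy
      by_cases h1 : s(x, y) = s(a, b)
      · apply F0
        rw [Sym2.eq_iff] at h1
        right
        rcases h1 with ⟨rfl, rfl⟩ | ⟨rfl, rfl⟩ <;> tauto
      · by_cases h2 : s(x, y) = s(c, d)
        · apply F0
          rw [Sym2.eq_iff] at h2
          right
          rcases h2 with ⟨rfl, rfl⟩ | ⟨rfl, rfl⟩ <;> tauto
        · exact F x y hxy h1 h2
    refine case_same G a b c d hab hcd hac had hbc hbd h ψ ?_ ?_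
    · intro v x y h1 h2 h3
      exact hprop v x y h1 h2 h3 (F' v x h1) (F' v y h2)
    · rw [F' a b hab, F' c d hcd, if_pos hKa, if_neg hKc.1, hα, hβ, Equiv.swap_apply_left]
  · have hcd' : (K c ∧ ¬ K d) ∨ (¬ K c ∧ K d) := by tauto
    have end1 : ∀ v w i, G.Adj v w → φ s(v, w) = i →
        (∀ x, G.Adj v x → x ≠ w → s(v, x) ≠ s(a, b) ∧ s(v, x) ≠ s(c, d)) →
        ∀ x, G.Adj v x → x ≠ w → ψ s(v, x) ≠ if K v then Equiv.swap α β i else i := by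
      intro v w i hvw hi hne x hx hxw
      rw [F v x hx (hne x hx hxw).1 (hne x hx hxw).2]
      have := hφ v x w hx hvw hxw
      rw [hi] at this
      split_ifs
      · exact fun h => this ((Equiv.swap α β).injective h)
      · exact this
    have A := end1 a b α hab hα (by
      intro x _ hx; simp only [ne_eq, Sym2.eq_iff]; grind)
    have B := end1 b a α hab.symm e1 (by
      intro x _ hx; simp only [ne_eq, Sym2.eq_iff]; grind)
    have C := end1 c d β hcd hβ (by
      intro x _ hx; simp only [ne_eq, Sym2.eq_iff]; grind)
    have D := end1 d c β hcd.symm e2 (by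
      intro x _ hx; simp only [ne_eq, Sym2.eq_iff]; grind)
    rw [if_pos hKa, Equiv.swap_apply_left] at A
    rw [if_neg hKb] at B
    rw [Equiv.swap_apply_right] at C D
    refine colourable_ext G a b c d n1 n2 hac had hbc hbd ψ ?_ _ _ _ _ k
      ?_ ?_ ?_ ?_ ?_ ?_ A B C D
    · intro v x y h1 h2 h3 h4 h5 h6 h7
      exact hprop v x y h1 h2 h3 (F v x h1 h4 h5) (F v y h2 h6 h7)
    · exact Ne.symm heq
    · exact hkβ.symm
    · exact hkα.symm
    · rcases hcd' with ⟨h1, h2⟩ | ⟨h1, h2⟩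
      · rw [if_pos h1, if_neg h2]; exact heq
      · rw [if_neg h1, if_pos h2]; exact Ne.symm heq
    · split_ifs
      · exact hkα.symm
      · exact hkβ.symm
    · split_ifs
      · exact hkα.symm
      · exact hkβ.symm

lemma square_adj (G : SimpleGraph V) (a b c d : V)
    (hac : a ≠ c) (had : a ≠ d) (hbc : b ≠ c) (hbd : b ≠ d)
    (C : (edgeInsertion G a b c d).Subgraph)
    (hC : IsTwoRegular C) (hC4 : C.verts.ncard = 4)
    (huv : C.Adj (Sum.inr 0) (Sum.inr 1)) :
    ∃ x y, (x = a ∨ x = b) ∧ (y = c ∨ y = d) ∧ G.Adj x y := by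
  have two : ∀ i : Fin 2, i = 0 ∨ i = 1 := by decide
  have other : ∀ v w, C.Adj v w → ∃ x, x ≠ w ∧ C.neighborSet v = {w, x} := by
    intro v w hvw
    obtain ⟨p, q, hpq, hs⟩ := Set.ncard_eq_two.1 (hC v hvw.fst_mem)
    have hw : w ∈ C.neighborSet v := hvw
    rw [hs] at hw
    rcases hw with rfl | rfl
    · exact ⟨q, hpq.symm, hs⟩
    · exact ⟨p, hpq, by rw [hs, Set.pair_comm]⟩
  obtain ⟨x, hx1, hxs⟩ := other _ _ huv
  obtain ⟨y, hy1, hys⟩ := other _ _ huv.symm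
  have hux : C.Adj (Sum.inr 0) x := by
    change x ∈ C.neighborSet _; rw [hxs]; simp
  have hvy : C.Adj (Sum.inr 1) y := by
    change y ∈ C.neighborSet _; rw [hys]; simp
  rcases x with x | i
  swap
  · exfalso
    have := hux.adj_sub.ne
    rcases two i with rfl | rfl <;> simp_all
  rcases y with y | i
  swap
  · exfalso
    have := hvy.adj_sub.ne
    rcases two i with rfl | rfl <;> simp_all
  have hx := (adj_l0 G a b c d x).1 hux.adj_sub.symm
  have hy := (adj_l1 G a b c d y).1 hvy.adj_sub.symm
  have hxy : x ≠ y := by grind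
  refine ⟨x, y, hx, hy, ?_⟩
  have hfin : C.verts.Finite := Set.finite_of_ncard_ne_zero (by rw [hC4]; norm_num)
  have hverts : ({Sum.inr 0, Sum.inr 1, Sum.inl x, Sum.inl y} : Set (V ⊕ Fin 2)) = C.verts := by
    apply Set.eq_of_subset_of_ncard_le _ _ hfin
    · rintro z (rfl | rfl | rfl | rfl)
      · exact huv.fst_mem
      · exact huv.snd_mem
      · exact hux.snd_mem
      · exact hvy.snd_mem
    · rw [hC4, Set.ncard_insert_of_notMem (by simp), Set.ncard_insert_of_notMem (by simp),
        Set.ncard_pair (by simpa using hxy)]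
  obtain ⟨z, hz, hzs⟩ := other _ _ hux.symm
  have hxz : C.Adj (Sum.inl x) z := by
    change z ∈ C.neighborSet _; rw [hzs]; simp
  have hzv := hxz.snd_mem
  rw [← hverts] at hzv
  rcases hzv with rfl | rfl | rfl | rfl
  · exact absurd rfl hz
  · have : (Sum.inl x : V ⊕ Fin 2) ∈ C.neighborSet (Sum.inr 1) := hxz.symm
    rw [hys] at this
    simp [hxy] at this
  · exact absurd rfl hxz.adj_sub.ne
  · exact ((adj_ll G a b c d x y).1 hxz.adj_sub).1

/-- if G is a colourable cubic graph and the new edge uv of the edge-insertion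
lies on a 4-cycle of G', then G' is colourable. -/
theorem edgeInsertion_colourable_of_new_edge_on_square {V : Type*} [Fintype V]
    (G : SimpleGraph V) (hG : IsCubic G) (hcol : Colourable3 G)
    (a b c d : V) (hab : G.Adj a b) (hcd : G.Adj c d)
    (hac : a ≠ c) (had : a ≠ d) (hbc : b ≠ c) (hbd : b ≠ d)
    (C : (edgeInsertion G a b c d).Subgraph)
    (hC : IsCycleSub C) (hC4 : C.verts.ncard = 4)
    (huv : s((Sum.inr 0 : V ⊕ Fin 2), (Sum.inr 1 : V ⊕ Fin 2)) ∈ C.edgeSet) :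
    Colourable3 (edgeInsertion G a b c d) := by
  obtain ⟨x, y, rfl | rfl, rfl | rfl, hxy⟩ :=
    square_adj G a b c d hac had hbc hbd C hC.2 hC4 huv
  · exact core G hG hcol _ _ _ _ hab hcd hac had hbc hbd hxy
  · rw [edgeInsertion_swap2]
    exact core G hG hcol _ _ _ _ hab hcd.symm had hac hbd hbc hxy
  · rw [edgeInsertion_swap1]
    exact core G hG hcol _ _ _ _ hab.symm hcd hbc hbd hac had hxy
  · rw [edgeInsertion_swap1, edgeInsertion_swap2]
    exact core G hG hcol _ _ _ _ hab.symm hcd.symm hbd hbc had hac hxy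

end SnarkPaper
end
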